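/- For any bounded measurable function φ on X: E[γ_n^N(φ)²] = Σ_{b ∈ B_n} [Π_{p=0}^n (1/N_p)^{b_p} (1 − 1/N_p)^{1−b_p}] μ_b(φ⊗φ). -/

import Mathlib

open MeasureTheory ProbabilityTheory Filter
open scoped ENNReal NNReal Classical

noncomputable section

namespace PFVar

variable {X : Type*} [MeasurableSpace X]

/-- The unnormalized Feynman–Kac measures `γ_p`. -/
def gammaFK (M0 : Measure X) (M : ℕ → Kernel X X) (G : ℕ → X → ℝ) : ℕ → Measure X
  | 0 => M0
  | p + 1 =>
      ((gammaFK M0 M G p).withDensity fun x => ENNReal.ofReal (G p x)).bind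
        (fun x => M (p + 1) x)

/-- `γ_n(φ)`. -/
def gInt (M0 : Measure X) (M : ℕ → Kernel X X) (G : ℕ → X → ℝ) (n : ℕ) (φ : X → ℝ) : ℝ :=
  ∫ x, φ x ∂(gammaFK M0 M G n)

/-- `η_n(φ) = γ_n(φ)/γ_n(1)`. -/
def eInt (M0 : Measure X) (M : ℕ → Kernel X X) (G : ℕ → X → ℝ) (n : ℕ) (φ : X → ℝ) : ℝ :=
  gInt M0 M G n φ / gInt M0 M G n 1

/-- Law of the path `(X_0,…,X_k)` of an inhomogeneous Markov chain with initial law `μ0` and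
transitions `κ`, recorded as an element of `ℕ → Y` (coordinates beyond `k` are junk). -/
def markovPath {Y : Type*} [MeasurableSpace Y] (μ0 : Measure Y) (κ : ℕ → Y → Measure Y) :
    ℕ → Measure (ℕ → Y)
  | 0 => μ0.map fun y _ => y
  | k + 1 =>
      (markovPath μ0 κ k).bind fun ω =>
        (κ (k + 1) (ω k)).map fun y => Function.update ω (k + 1) y

/-- Categorical distribution on `{0,…,m−1} ⊆ ℕ` with weights `w`. -/
def cat (m : ℕ) (w : ℕ → ℝ) : Measure ℕ :=
  (∑ j ∈ Finset.range m, ENNReal.ofReal (w j))⁻¹ •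
    ∑ j ∈ Finset.range m, ENNReal.ofReal (w j) • Measure.dirac j

/-- Uniform distribution on `{0,…,m−1}`. -/
def unif (m : ℕ) : Measure ℕ := cat m fun _ => 1

/-- Extend a finite tuple to `ℕ` with junk values. -/
def padF {Y : Type*} [Nonempty Y] {m : ℕ} (f : Fin m → Y) : ℕ → Y := fun i =>
  if h : i < m then f ⟨i, h⟩ else Classical.arbitrary Y

/-- One resampling/mutation step of the particle filter: given the time-`p` configuration `z`,
the joint law of the ancestor indices `A_p` and the time-`p+1` particle configuration;
each of the `Np (p+1)` new particles independently draws an ancestor from the categorical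
distribution with weights `G p (z j)`, `j < Np p`, and then moves according to `M (p+1)`. -/
def pfStep [Nonempty X] (M : ℕ → Kernel X X) (G : ℕ → X → ℝ) (Np : ℕ → ℕ) (p : ℕ)
    (z : ℕ → X) : Measure ((ℕ → ℕ) × (ℕ → X)) :=
  (Measure.pi fun _ : Fin (Np (p + 1)) =>
      (cat (Np p) fun j => G p (z j)).bind fun a =>
        (M (p + 1) (z a)).map fun x => (a, x)).map fun f =>
    (padF fun i => (f i).1, padF fun i => (f i).2)

/-- The law of the particle system `(ζ, A)` run up to time `k`: the first component is
`ζ : time → particle index → X`, the second is `A : time → particle index → ℕ`, where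
`A p i` is the ancestor index of particle `i` of generation `p+1`. -/
def pfLaw [Nonempty X] (M0 : Measure X) (M : ℕ → Kernel X X) (G : ℕ → X → ℝ)
    (Np : ℕ → ℕ) : ℕ → Measure ((ℕ → ℕ → X) × (ℕ → ℕ → ℕ))
  | 0 =>
      (Measure.pi fun _ : Fin (Np 0) => M0).map fun f =>
        (fun p => if p = 0 then padF f else fun _ => Classical.arbitrary X, fun _ _ => 0)
  | k + 1 =>
      (pfLaw M0 M G Np k).bind fun ω =>
        (pfStep M G Np k (ω.1 k)).map fun az =>
          (Function.update ω.1 (k + 1) az.2, Function.update ω.2 k az.1)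

/-- Eve indices: `eve A 0 i = i` and `eve A (p+1) i = eve A p (A p i)`. -/
def eve (A : ℕ → ℕ → ℕ) : ℕ → ℕ → ℕ
  | 0 => fun i => i
  | p + 1 => fun i => eve A p (A p i)

/-- `η_n^N(φ)`. -/
def etaN (Np : ℕ → ℕ) (n : ℕ) (φ : X → ℝ) (ω : (ℕ → ℕ → X) × (ℕ → ℕ → ℕ)) : ℝ :=
  (Np n : ℝ)⁻¹ * ∑ i ∈ Finset.range (Np n), φ (ω.1 n i)

/-- `γ_n^N(φ)`. -/
def gammaN (G : ℕ → X → ℝ) (Np : ℕ → ℕ) (n : ℕ) (φ : X → ℝ)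
    (ω : (ℕ → ℕ → X) × (ℕ → ℕ → ℕ)) : ℝ :=
  (∏ p ∈ Finset.range n, etaN Np p (G p) ω) * etaN Np n φ ω

/-- The variance estimator `V_n^N(φ)`. -/
def Vest (Np : ℕ → ℕ) (n : ℕ) (φ : X → ℝ) (ω : (ℕ → ℕ → X) × (ℕ → ℕ → ℕ)) : ℝ :=
  etaN Np n φ ω ^ 2 -
    (∏ p ∈ Finset.range n, (Np p : ℝ) / ((Np p : ℝ) - 1)) *
      ((Np n : ℝ) * ((Np n : ℝ) - 1))⁻¹ *
      ∑ i ∈ Finset.range (Np n), ∑ j ∈ Finset.range (Np n),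
        if eve ω.2 n i ≠ eve ω.2 n j then φ (ω.1 n i) * φ (ω.1 n j) else 0

/-- Initial law of the doubled chain used to define `μ_b`. -/
def pairInit (M0 : Measure X) (b : ℕ → Bool) : Measure (X × X) :=
  if b 0 then M0.map fun x => (x, x) else M0.prod M0

/-- Transitions of the doubled chain used to define `μ_b`. -/
def pairKer (M : ℕ → Kernel X X) (b : ℕ → Bool) (p : ℕ) (q : X × X) : Measure (X × X) :=
  if b p then (M p q.1).map fun y => (y, y) else (M p q.1).prod (M p q.2)

/-- `μ_b(φ) = E_b[φ(X_n, X_n') ∏_{p<n} G_p(X_p) G_p(X_p')]`. -/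
def muB (M0 : Measure X) (M : ℕ → Kernel X X) (G : ℕ → X → ℝ) (n : ℕ) (b : ℕ → Bool)
    (φ : X × X → ℝ) : ℝ :=
  ∫ ω, φ (ω n) * ∏ p ∈ Finset.range n, G p (ω p).1 * G p (ω p).2
    ∂(markovPath (pairInit M0 b) (pairKer M b) n)

/-- `φ ⊗ φ`. -/
def tens (φ : X → ℝ) : X × X → ℝ := fun q => φ q.1 * φ q.2

/-- The binary string `e_p`. -/
def eVec (p : ℕ) : ℕ → Bool := fun q => q == p

/-- The zero binary string `0_n`. -/
def zeroVec : ℕ → Bool := fun _ => false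

/-- Extension of a finite binary string to `ℕ → Bool`. -/
def extB (n : ℕ) (b : Fin (n + 1) → Bool) : ℕ → Bool := fun p =>
  if h : p < n + 1 then b ⟨p, h⟩ else false

/-- `v_{p,n}(φ) = (μ_{e_p}(φ⊗φ) − μ_{0_n}(φ⊗φ)) / γ_n(1)²`. -/
def vpn (M0 : Measure X) (M : ℕ → Kernel X X) (G : ℕ → X → ℝ) (n p : ℕ) (φ : X → ℝ) : ℝ :=
  (muB M0 M G n (eVec p) (tens φ) - muB M0 M G n zeroVec (tens φ)) / gInt M0 M G n 1 ^ 2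

/-- `σ_n²(φ) = Σ_{p=0}^n c_p⁻¹ v_{p,n}(φ)`. -/
def sigma2 (M0 : Measure X) (M : ℕ → Kernel X X) (G : ℕ → X → ℝ) (c : ℕ → ℝ) (n : ℕ)
    (φ : X → ℝ) : ℝ :=
  ∑ p ∈ Finset.range (n + 1), (c p)⁻¹ * vpn M0 M G n p φ

/-- Particle numbers `N_p = ⌈c_p N⌉`. -/
def npart (c : ℕ → ℝ) (N : ℕ) (p : ℕ) : ℕ := ⌈c p * (N : ℝ)⌉₊

/-- Backward tracing: `traceAux A n kn j = K_{n-j}` where `K_n = kn`, `K_p = A p (K_{p+1})`. -/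
def traceAux (A : ℕ → ℕ → ℕ) (n kn : ℕ) : ℕ → ℕ
  | 0 => kn
  | j + 1 => A (n - (j + 1)) (traceAux A n kn j)

/-- The deterministic ancestral trace `K¹`: `trace A n kn p = K_p¹` given `K_n¹ = kn`. -/
def trace (A : ℕ → ℕ → ℕ) (n kn : ℕ) : ℕ → ℕ := fun p => traceAux A n kn (n - p)

/-- Conditional law of the broken-lineage trace `(K_0²,…,K_p²)` given `K_p² = v`
(entries above `p` are junk, to be overwritten). -/
def k2Law (G : ℕ → X → ℝ) (Np : ℕ → ℕ) (ω : (ℕ → ℕ → X) × (ℕ → ℕ → ℕ)) (K1 : ℕ → ℕ) :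
    ℕ → ℕ → Measure (ℕ → ℕ)
  | 0 => fun v => Measure.dirac fun q => if q = 0 then v else 0
  | p + 1 => fun v =>
      ((if v = K1 (p + 1) then cat (Np p) fun j => G p (ω.1 p j)
          else Measure.dirac (ω.2 p v)).bind fun w =>
        (k2Law G Np ω K1 p w).map fun f => Function.update f (p + 1) v)

/-- Conditional law of `(K¹, K²)` given the particle system `ω = (ζ, A)`. -/
def kLaw (G : ℕ → X → ℝ) (Np : ℕ → ℕ) (n : ℕ) (ω : (ℕ → ℕ → X) × (ℕ → ℕ → ℕ)) :
    Measure ((ℕ → ℕ) × (ℕ → ℕ)) :=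
  (unif (Np n)).bind fun k1n =>
    (unif (Np n)).bind fun k2n =>
      (k2Law G Np ω (trace ω.2 n k1n) n k2n).map fun k2 => (trace ω.2 n k1n, k2)

/-- Joint law of the particle system together with the tracing variables `(K¹, K²)`. -/
def pfkLaw [Nonempty X] (M0 : Measure X) (M : ℕ → Kernel X X) (G : ℕ → X → ℝ)
    (Np : ℕ → ℕ) (n : ℕ) :
    Measure (((ℕ → ℕ → X) × (ℕ → ℕ → ℕ)) × ((ℕ → ℕ) × (ℕ → ℕ))) :=
  (pfLaw M0 M G Np n).bind fun ω => (kLaw G Np n ω).map fun k => (ω, k)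

/-- `(k¹, k²) ∈ I(b)`. -/
def inI (Np : ℕ → ℕ) (n : ℕ) (b : ℕ → Bool) (k : (ℕ → ℕ) × (ℕ → ℕ)) : Prop :=
  ∀ p ≤ n, k.1 p < Np p ∧ k.2 p < Np p ∧ (k.1 p = k.2 p ↔ b p = true)

/-- The particle approximation `μ_b^N(φ)` (a function of the realization `ω = (ζ, A)`);
the conditional expectation given `(A, ζ)` is the integral with respect to `kLaw`. -/
def muBN (G : ℕ → X → ℝ) (Np : ℕ → ℕ) (n : ℕ) (b : ℕ → Bool) (φ : X × X → ℝ)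
    (ω : (ℕ → ℕ → X) × (ℕ → ℕ → ℕ)) : ℝ :=
  (∏ p ∈ Finset.range (n + 1),
      if b p then (Np p : ℝ) else (Np p : ℝ) / ((Np p : ℝ) - 1)) *
    gammaN G Np n 1 ω ^ 2 *
    ∫ k, (if inI Np n b k then (1 : ℝ) else 0) * φ (ω.1 n (k.1 n), ω.1 n (k.2 n))
      ∂(kLaw G Np n ω)

/-- `v_{p,n}^N(φ)`. -/
def vpnN (G : ℕ → X → ℝ) (Np : ℕ → ℕ) (n p : ℕ) (φ : X → ℝ)
    (ω : (ℕ → ℕ → X) × (ℕ → ℕ → ℕ)) : ℝ :=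
  (muBN G Np n (eVec p) (tens φ) ω - muBN G Np n zeroVec (tens φ) ω) / gammaN G Np n 1 ω ^ 2

/-- `v_n^N(φ) = Σ_{p=0}^n c_p⁻¹ v_{p,n}^N(φ)`. -/
def vnN (G : ℕ → X → ℝ) (Np : ℕ → ℕ) (c : ℕ → ℝ) (n : ℕ) (φ : X → ℝ)
    (ω : (ℕ → ℕ → X) × (ℕ → ℕ → ℕ)) : ℝ :=
  ∑ p ∈ Finset.range (n + 1), (c p)⁻¹ * vpnN G Np n p φ ω

/-- `QAux M G n φ j = Q_{n-j,n}(φ)`. -/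
def QAux (M : ℕ → Kernel X X) (G : ℕ → X → ℝ) (n : ℕ) (φ : X → ℝ) : ℕ → X → ℝ
  | 0 => φ
  | j + 1 => fun x => G (n - (j + 1)) x * ∫ y, QAux M G n φ j y ∂(M (n - j) x)

/-- `Q_{p,n}(φ)` where `Q_p(x, dx') = G_{p-1}(x) M_p(x, dx')`, `Q_{n,n} = Id`,
`Q_{p,n} = Q_{p+1} ⋯ Q_n`. -/
def Qpn (M : ℕ → Kernel X X) (G : ℕ → X → ℝ) (n p : ℕ) (φ : X → ℝ) : X → ℝ :=
  QAux M G n φ (n - p)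

/-- `φ̂ = G_n · φ`. -/
def hatf (G : ℕ → X → ℝ) (n : ℕ) (φ : X → ℝ) : X → ℝ := fun x => G n x * φ x

/-- `γ̂_n(φ) = γ_n(G_n φ)`. -/
def gHatInt (M0 : Measure X) (M : ℕ → Kernel X X) (G : ℕ → X → ℝ) (n : ℕ) (φ : X → ℝ) : ℝ :=
  gInt M0 M G n (hatf G n φ)

/-- `η̂_n(φ) = γ̂_n(φ)/γ̂_n(1)`. -/
def eHatInt (M0 : Measure X) (M : ℕ → Kernel X X) (G : ℕ → X → ℝ) (n : ℕ) (φ : X → ℝ) : ℝ :=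
  gHatInt M0 M G n φ / gHatInt M0 M G n 1

/-- `γ̂_n^N(φ) = γ_n^N(G_n φ)`. -/
def gammaHatN (G : ℕ → X → ℝ) (Np : ℕ → ℕ) (n : ℕ) (φ : X → ℝ)
    (ω : (ℕ → ℕ → X) × (ℕ → ℕ → ℕ)) : ℝ :=
  gammaN G Np n (hatf G n φ) ω

/-- `η̂_n^N(φ) = γ̂_n^N(φ)/γ̂_n^N(1)`. -/
def etaHatN (G : ℕ → X → ℝ) (Np : ℕ → ℕ) (n : ℕ) (φ : X → ℝ)
    (ω : (ℕ → ℕ → X) × (ℕ → ℕ → ℕ)) : ℝ :=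
  gammaHatN G Np n φ ω / gammaHatN G Np n 1 ω

/-- `v̂_{p,n}(φ) = v_{p,n}(φ̂)/η_n(G_n)²`. -/
def vpnHat (M0 : Measure X) (M : ℕ → Kernel X X) (G : ℕ → X → ℝ) (n p : ℕ) (φ : X → ℝ) : ℝ :=
  vpn M0 M G n p (hatf G n φ) / eInt M0 M G n (G n) ^ 2

/-- `σ̂_n²(φ) = Σ_{p=0}^n c_p⁻¹ v̂_{p,n}(φ)`. -/
def sigma2Hat (M0 : Measure X) (M : ℕ → Kernel X X) (G : ℕ → X → ℝ) (c : ℕ → ℝ) (n : ℕ)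
    (φ : X → ℝ) : ℝ :=
  ∑ p ∈ Finset.range (n + 1), (c p)⁻¹ * vpnHat M0 M G n p φ

/-- `V̂_n^N(φ) = V_n^N(φ̂)/η_n^N(G_n)²`. -/
def VestHat (G : ℕ → X → ℝ) (Np : ℕ → ℕ) (n : ℕ) (φ : X → ℝ)
    (ω : (ℕ → ℕ → X) × (ℕ → ℕ → ℕ)) : ℝ :=
  Vest Np n (hatf G n φ) ω / etaN Np n (G n) ω ^ 2

/-- `v̂_{p,n}^N(φ) = v_{p,n}^N(φ̂)/η_n^N(G_n)²`. -/
def vpnHatN (G : ℕ → X → ℝ) (Np : ℕ → ℕ) (n p : ℕ) (φ : X → ℝ)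
    (ω : (ℕ → ℕ → X) × (ℕ → ℕ → ℕ)) : ℝ :=
  vpnN G Np n p (hatf G n φ) ω / etaN Np n (G n) ω ^ 2

/-- `v̂_n^N(φ) = Σ_{p=0}^n c_p⁻¹ v̂_{p,n}^N(φ)`. -/
def vnHatN (G : ℕ → X → ℝ) (Np : ℕ → ℕ) (c : ℕ → ℝ) (n : ℕ) (φ : X → ℝ)
    (ω : (ℕ → ℕ → X) × (ℕ → ℕ → ℕ)) : ℝ :=
  ∑ p ∈ Finset.range (n + 1), (c p)⁻¹ * vpnHatN G Np n p φ ω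

open PFVar MeasureTheory ProbabilityTheory Filter

/-- A bounded measurable real-valued function. -/
structure BddMeas {Y : Type*} [MeasurableSpace Y] (f : Y → ℝ) : Prop where
  measurable : Measurable f
  bounded : ∃ C, ∀ y, |f y| ≤ C

namespace BddMeas

variable {Y Z : Type*} [MeasurableSpace Y] [MeasurableSpace Z]

lemma integrable {f : Y → ℝ} (hf : BddMeas f) (μ : Measure Y) [IsFiniteMeasure μ] :
    Integrable f μ := by
  obtain ⟨C, hC⟩ := hf.bounded
  exact Integrable.of_bound hf.measurable.aestronglyMeasurable C (ae_of_all _ hC)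

lemma const (c : ℝ) : BddMeas fun _ : Y => c :=
  ⟨measurable_const, |c|, fun _ => le_rfl⟩

lemma comp {f : Z → ℝ} (hf : BddMeas f) {g : Y → Z} (hg : Measurable g) :
    BddMeas fun y => f (g y) :=
  ⟨hf.measurable.comp hg, hf.bounded.imp fun _ h y => h (g y)⟩

lemma add {f g : Y → ℝ} (hf : BddMeas f) (hg : BddMeas g) : BddMeas fun y => f y + g y := by
  obtain ⟨C, hC⟩ := hf.bounded
  obtain ⟨D, hD⟩ := hg.bounded
  exact ⟨hf.measurable.add hg.measurable, C + D,
    fun y => (abs_add_le _ _).trans (add_le_add (hC y) (hD y))⟩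

lemma mul {f g : Y → ℝ} (hf : BddMeas f) (hg : BddMeas g) : BddMeas fun y => f y * g y := by
  obtain ⟨C, hC⟩ := hf.bounded
  obtain ⟨D, hD⟩ := hg.bounded
  refine ⟨hf.measurable.mul hg.measurable, C * D, fun y => ?_⟩
  rw [abs_mul]
  exact mul_le_mul (hC y) (hD y) (abs_nonneg _) ((abs_nonneg _).trans (hC y))

lemma sum {ι : Type*} (s : Finset ι) {f : ι → Y → ℝ} (hf : ∀ i ∈ s, BddMeas (f i)) :
    BddMeas fun y => ∑ i ∈ s, f i y := by
  induction s using Finset.induction_on with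
  | empty => simpa using const 0
  | insert a s ha ih =>
    simp only [Finset.sum_insert ha]
    exact (hf a (by simp)).add (ih fun i hi => hf i (by simp [hi]))

lemma prod {ι : Type*} (s : Finset ι) {f : ι → Y → ℝ} (hf : ∀ i ∈ s, BddMeas (f i)) :
    BddMeas fun y => ∏ i ∈ s, f i y := by
  induction s using Finset.induction_on with
  | empty => simpa using const 1
  | insert a s ha ih =>
    simp only [Finset.prod_insert ha]
    exact (hf a (by simp)).mul (ih fun i hi => hf i (by simp [hi]))

lemma integral {f : Z → ℝ} (hf : BddMeas f) {κ : Y → Measure Z} (hκ : Measurable κ)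
    (hp : ∀ y, IsProbabilityMeasure (κ y)) : BddMeas fun y => ∫ z, f z ∂(κ y) := by
  obtain ⟨C, hC⟩ := hf.bounded
  refine ⟨?_, C, fun y => ?_⟩
  · exact (StronglyMeasurable.integral_kernel (κ := ⟨κ, hκ⟩)
      hf.measurable.stronglyMeasurable).measurable
  · have := norm_integral_le_of_norm_le_const (μ := κ y) (f := f) (C := C)
      (ae_of_all _ hC)
    simpa using this

lemma integral_bind {f : Z → ℝ} (hf : BddMeas f) (μ : Measure Y) [IsProbabilityMeasure μ]
    {κ : Y → Measure Z} (hκ : Measurable κ) (hp : ∀ y, IsProbabilityMeasure (κ y)) :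
    ∫ z, f z ∂(μ.bind κ) = ∫ y, ∫ z, f z ∂(κ y) ∂μ := by
  have := isProbabilityMeasure_bind (m := μ) hκ.aemeasurable (ae_of_all _ hp)
  have h : (Kernel.comp ⟨κ, hκ⟩ (Kernel.const Unit μ)) () = μ.bind κ := by
    rw [Kernel.comp_apply]; rfl
  have := Kernel.integral_comp (κ := Kernel.const Unit μ) (η := ⟨κ, hκ⟩) (a := ())
    (f := f) (by rw [h]; exact hf.integrable _)
  rw [h] at this
  exact this

end BddMeas

lemma measurable_measure_pi {ι Y Z : Type*} [Fintype ι] [MeasurableSpace Y] [MeasurableSpace Z]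
    {κ : Y → Measure Z} (hκ : Measurable κ) (hp : ∀ y, IsProbabilityMeasure (κ y)) :
    Measurable fun y => Measure.pi fun _ : ι => κ y := by
  refine Measurable.measure_of_isPiSystem_of_isProbabilityMeasure generateFrom_pi.symm
    isPiSystem_pi ?_
  rintro _ ⟨s, hs, rfl⟩
  simp only [Measure.pi_pi]
  exact Finset.measurable_prod _ fun i _ => Measure.measurable_coe (hs i (Set.mem_univ i)) |>.comp hκ

/-- Second moment of the empirical measure of an i.i.d. sample. -/
lemma integral_pi_sum_sum {Y : Type*} [MeasurableSpace Y] (ν : Measure Y)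
    [IsProbabilityMeasure ν] {F : Y × Y → ℝ} (hF : BddMeas F) {m : ℕ} (hm : 0 < m) :
    ∫ f, ((m : ℝ)⁻¹) ^ 2 * ∑ i : Fin m, ∑ j : Fin m, F (f i, f j)
        ∂(Measure.pi fun _ : Fin m => ν)
      = (m : ℝ)⁻¹ * ∫ y, F (y, y) ∂ν + (1 - (m : ℝ)⁻¹) * ∫ q, F q ∂(ν.prod ν) := by
  have hdiag : ∀ i : Fin m, ∫ f, F (f i, f i) ∂(Measure.pi fun _ : Fin m => ν)
      = ∫ y, F (y, y) ∂ν := fun i => by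
    have h := (measurePreserving_eval (fun _ : Fin m => ν) i).map_eq
    have h2 := integral_map (μ := Measure.pi fun _ : Fin m => ν)
      (measurable_pi_apply i).aemeasurable (f := fun y => F (y, y))
      (hF.comp (measurable_id.prodMk measurable_id)).measurable.aestronglyMeasurable
    rw [← h2]
    exact congrArg (fun μ => ∫ y, F (y, y) ∂μ) h
  have hoff : ∀ i j : Fin m, i ≠ j → ∫ f, F (f i, f j) ∂(Measure.pi fun _ : Fin m => ν)
      = ∫ q, F q ∂(ν.prod ν) := fun i j hij => by
    have hind := (iIndepFun_pi (μ := fun _ : Fin m => ν) (X := fun _ => id)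
      fun _ => aemeasurable_id).indepFun hij
    have h := hind.map_prod_eq_prod_map_map (measurable_pi_apply i).aemeasurable
      (measurable_pi_apply j).aemeasurable
    have hi := (measurePreserving_eval (fun _ : Fin m => ν) i).map_eq
    have hj := (measurePreserving_eval (fun _ : Fin m => ν) j).map_eq
    have h' : (Measure.pi fun _ : Fin m => ν).map (fun f => (f i, f j)) = ν.prod ν := by
      refine h.trans ?_
      congr 1
    rw [← h', integral_map ((measurable_pi_apply i).prodMk (measurable_pi_apply j)).aemeasurable
      hF.measurable.aestronglyMeasurable]
  have hB : ∀ i j : Fin m, BddMeas fun f : Fin m → Y => F (f i, f j) := fun i j =>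
    hF.comp ((measurable_pi_apply i).prodMk (measurable_pi_apply j))
  have hval : ∀ i j : Fin m, ∫ f, F (f i, f j) ∂(Measure.pi fun _ : Fin m => ν)
      = ∫ q, F q ∂(ν.prod ν) + if i = j then ∫ y, F (y, y) ∂ν - ∫ q, F q ∂(ν.prod ν) else 0 := by
    intro i j
    split_ifs with h
    · subst h; rw [hdiag]; ring
    · rw [hoff i j h, add_zero]
  rw [integral_const_mul, integral_finsetSum _ fun i _ =>
    (BddMeas.sum _ fun j _ => hB i j).integrable _]
  simp_rw [integral_finsetSum Finset.univ fun j _ => (hB _ j).integrable _, hval]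
  simp only [Finset.sum_add_distrib, Finset.sum_const, Finset.sum_ite_eq, Finset.mem_univ,
    if_true, Finset.card_univ, Fintype.card_fin, nsmul_eq_mul]
  have : (m : ℝ) ≠ 0 := by positivity
  field_simp
  ring

section Particle

variable {X : Type*} [MeasurableSpace X]

/-- The conditional law of one ancestor index and offspring position, given the parents `z`. -/
def offspringLaw (K : Kernel X X) (g : X → ℝ) (m : ℕ) (z : ℕ → X) : Measure (ℕ × X) :=
  (cat m fun j => g (z j)).bind fun a => (K (z a)).map fun x => (a, x)

variable {K : Kernel X X} {g : X → ℝ} {m : ℕ}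

lemma offspringLaw_eq (z : ℕ → X) :
    offspringLaw K g m z = (∑ j ∈ Finset.range m, ENNReal.ofReal (g (z j)))⁻¹ •
      ∑ j ∈ Finset.range m, ENNReal.ofReal (g (z j)) • (K (z j)).map fun x => (j, x) := by
  ext s hs
  rw [offspringLaw, Measure.bind_apply hs (measurable_of_countable _).aemeasurable, cat]
  simp [lintegral_dirac]

lemma measurable_offspringLaw (hg : Measurable g) :
    Measurable (offspringLaw K g m) := by
  refine Measure.measurable_of_measurable_coe _ fun s hs => ?_
  simp_rw [offspringLaw_eq]
  simp only [Measure.smul_apply, Measure.finsetSum_apply, smul_eq_mul]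
  have hz : ∀ j, Measurable fun z : ℕ → X => ENNReal.ofReal (g (z j)) := fun j =>
    (hg.comp (measurable_pi_apply j)).ennreal_ofReal
  refine (Finset.measurable_sum _ fun j _ => hz j).inv.mul
    (Finset.measurable_sum _ fun j _ => (hz j).mul ?_)
  simp_rw [Measure.map_apply measurable_prodMk_left hs]
  exact (K.measurable_coe (measurable_prodMk_left hs)).comp (measurable_pi_apply j)

lemma isProbabilityMeasure_offspringLaw [IsMarkovKernel K] (hg : ∀ x, 0 < g x) (hm : 0 < m)
    (z : ℕ → X) : IsProbabilityMeasure (offspringLaw K g m z) := by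
  refine ⟨?_⟩
  rw [offspringLaw_eq]
  simp only [Measure.smul_apply, Measure.finsetSum_apply, smul_eq_mul]
  have h : ∀ j, ((K (z j)).map fun x => (j, x)) Set.univ = 1 := fun j => by
    rw [Measure.map_apply measurable_prodMk_left MeasurableSet.univ]
    simp
  simp_rw [h, mul_one]
  refine ENNReal.inv_mul_cancel ?_ ?_
  · rw [Ne, Finset.sum_eq_zero_iff]
    push Not
    exact ⟨0, by simpa using hm, by simpa using hg _⟩
  · exact ENNReal.sum_ne_top.2 fun j _ => ENNReal.ofReal_ne_top

lemma integral_offspringLaw [IsMarkovKernel K] (hg : ∀ x, 0 < g x) (z : ℕ → X)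
    {f : X → ℝ} (hf : BddMeas f) :
    ∫ y, f y.2 ∂(offspringLaw K g m z) = (∑ j ∈ Finset.range m, g (z j))⁻¹ *
      ∑ j ∈ Finset.range m, g (z j) * ∫ x, f x ∂(K (z j)) := by
  have hB : BddMeas fun y : ℕ × X => f y.2 := hf.comp measurable_snd
  rw [offspringLaw_eq, integral_smul_measure, integral_finsetSum_measure]
  · simp_rw [integral_smul_measure]
    have h : ∀ j, ∫ y, f y.2 ∂((K (z j)).map fun x => (j, x)) = ∫ x, f x ∂(K (z j)) := fun j =>
      integral_map measurable_prodMk_left.aemeasurable hB.measurable.aestronglyMeasurable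
    simp_rw [h, smul_eq_mul, ENNReal.toReal_ofReal (hg _).le, ENNReal.toReal_inv]
    rw [ENNReal.toReal_sum fun j _ => ENNReal.ofReal_ne_top]
    simp_rw [ENNReal.toReal_ofReal (hg _).le]
  · intro j _
    have : IsFiniteMeasure ((K (z j)).map fun x => (j, x)) := inferInstance
    exact (hB.integrable _).smul_measure ENNReal.ofReal_ne_top

/-- The empirical mean of `F` over all pairs of the first `m` particles. -/
def pairMean (m : ℕ) (F : X × X → ℝ) (z : ℕ → X) : ℝ :=
  ((m : ℝ)⁻¹) ^ 2 * ∑ i ∈ Finset.range m, ∑ j ∈ Finset.range m, F (z i, z j)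

lemma bddMeas_pairMean {F : X × X → ℝ} (hF : BddMeas F) : BddMeas (pairMean m F) :=
  (BddMeas.const _).mul <| .sum _ fun i _ => .sum _ fun j _ =>
    hF.comp ((measurable_pi_apply i).prodMk (measurable_pi_apply j))

lemma measurable_padF {Y : Type*} [MeasurableSpace Y] [Nonempty Y] {m : ℕ} :
    Measurable (padF : (Fin m → Y) → ℕ → Y) := by
  refine measurable_pi_lambda _ fun i => ?_
  unfold padF
  split_ifs with h
  · exact measurable_pi_apply _
  · exact measurable_const

lemma pairMean_padF {Y : Type*} [Nonempty Y] (F : Y × Y → ℝ) (f : Fin m → Y) :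
    pairMean m F (padF f) = ((m : ℝ)⁻¹) ^ 2 * ∑ i : Fin m, ∑ j : Fin m, F (f i, f j) := by
  simp [pairMean, Finset.sum_range, padF]

/-- The weighted one-step operator of the doubled chain whose two copies merge with
probability `t`. -/
def pairStep (K : Kernel X X) (g : X → ℝ) (t : ℝ) (F : X × X → ℝ) (q : X × X) : ℝ :=
  g q.1 * g q.2 * (t * ∫ y, F (y, y) ∂(K q.1) + (1 - t) * ∫ y, F y ∂((K q.1).prod (K q.2)))

lemma mean_sq_mul_integral_offspring [IsMarkovKernel K] (hg : ∀ x, 0 < g x) (hm : 0 < m)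
    (t : ℝ) {F : X × X → ℝ} (hF : BddMeas F) (z : ℕ → X) :
    ((m : ℝ)⁻¹ * ∑ i ∈ Finset.range m, g (z i)) ^ 2 *
      (t * ∫ y, F (y.2, y.2) ∂(offspringLaw K g m z) + (1 - t) *
        ∫ q, F (q.1.2, q.2.2) ∂((offspringLaw K g m z).prod (offspringLaw K g m z)))
      = pairMean m (pairStep K g t F) z := by
  have := isProbabilityMeasure_offspringLaw (K := K) hg hm z
  have hd : BddMeas fun y : X => F (y, y) := hF.comp (measurable_id.prodMk measurable_id)
  have hW : (∑ j ∈ Finset.range m, g (z j)) ≠ 0 :=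
    (Finset.sum_pos (fun j _ => hg _) ⟨0, by simpa using hm⟩).ne'
  have h2 : ∫ q, F (q.1.2, q.2.2) ∂((offspringLaw K g m z).prod (offspringLaw K g m z))
      = (∑ j ∈ Finset.range m, g (z j))⁻¹ ^ 2 * ∑ i ∈ Finset.range m, ∑ j ∈ Finset.range m,
        g (z i) * g (z j) * ∫ q, F q ∂((K (z i)).prod (K (z j))) := by
    have hb1 : BddMeas fun q : (ℕ × X) × (ℕ × X) => F (q.1.2, q.2.2) :=
      hF.comp (by fun_prop)
    have hb2 : ∀ x : X, BddMeas fun y : X => F (x, y) := fun x =>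
      hF.comp measurable_prodMk_left
    have hb3 : ∀ j, BddMeas fun x : X => ∫ y, F (x, y) ∂(K (z j)) := fun j => by
      refine ⟨?_, ?_⟩
      · exact (hF.measurable.stronglyMeasurable.integral_prod_right' (ν := K (z j))).measurable
      · obtain ⟨C, hC⟩ := hF.bounded
        refine ⟨C, fun x => ?_⟩
        have := norm_integral_le_of_norm_le_const (μ := K (z j)) (f := fun y => F (x, y)) (C := C)
          (ae_of_all _ fun y => hC _)
        simpa using this
    rw [integral_prod _ (hb1.integrable _)]
    simp only
    simp_rw [integral_offspringLaw hg z (hb2 _)]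
    rw [integral_offspringLaw (f := fun x => (∑ j ∈ Finset.range m, g (z j))⁻¹ *
      ∑ j ∈ Finset.range m, g (z j) * ∫ y, F (x, y) ∂(K (z j))) hg z
      ((BddMeas.const _).mul (.sum _ fun j _ => (BddMeas.const _).mul (hb3 j)))]
    simp_rw [integral_const_mul]
    simp_rw [integral_finsetSum _ fun j _ => ((BddMeas.const (g (z j))).mul (hb3 j)).integrable _,
      integral_const_mul, integral_prod _ (hF.integrable _), Finset.mul_sum]
    refine Finset.sum_congr rfl fun i _ => Finset.sum_congr rfl fun j _ => ?_
    ring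
  rw [integral_offspringLaw hg z hd, h2]
  simp only [pairMean, pairStep]
  have h3 : ∑ i ∈ Finset.range m, ∑ j ∈ Finset.range m, g (z i) * g (z j) *
      (t * ∫ y, F (y, y) ∂(K (z i)) + (1 - t) * ∫ y, F y ∂((K (z i)).prod (K (z j))))
      = t * ((∑ j ∈ Finset.range m, g (z j)) *
        ∑ i ∈ Finset.range m, g (z i) * ∫ y, F (y, y) ∂(K (z i)))
        + (1 - t) * ∑ i ∈ Finset.range m, ∑ j ∈ Finset.range m,
          g (z i) * g (z j) * ∫ q, F q ∂((K (z i)).prod (K (z j))) := by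
    rw [Finset.sum_mul_sum, Finset.sum_comm (s := Finset.range m) (t := Finset.range m)
      (f := fun i j => g (z i) * (g (z j) * _))]
    simp_rw [Finset.mul_sum, ← Finset.sum_add_distrib]
    refine Finset.sum_congr rfl fun i _ => Finset.sum_congr rfl fun j _ => ?_
    ring
  rw [h3]
  field_simp

end Particle

lemma measurable_measure_map {Y Z W : Type*} [MeasurableSpace Y] [MeasurableSpace Z]
    [MeasurableSpace W] {κ : Y → Measure Z} (hκ : Measurable κ)
    (hp : ∀ y, IsProbabilityMeasure (κ y)) {f : Y → Z → W} (hf : Measurable (Function.uncurry f)) :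
    Measurable fun y => (κ y).map (f y) := by
  have : IsMarkovKernel (⟨κ, hκ⟩ : Kernel Y Z) := ⟨hp⟩
  refine Measure.measurable_of_measurable_coe _ fun s hs => ?_
  have h : ∀ y, (κ y).map (f y) s = κ y (Prod.mk y ⁻¹' (Function.uncurry f ⁻¹' s)) := fun y =>
    Measure.map_apply (hf.comp measurable_prodMk_left) hs
  simp_rw [h]
  exact Kernel.measurable_kernel_prodMk_left (κ := ⟨κ, hκ⟩) (hf hs)

section ParticleFilter

variable {X : Type*} [MeasurableSpace X]

lemma bddMeas_etaN (Np : ℕ → ℕ) (p : ℕ) {f : X → ℝ} (hf : BddMeas f) :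
    BddMeas (etaN Np p f) := by
  refine (BddMeas.const _).mul (.sum _ fun i _ => hf.comp ?_)
  exact (measurable_pi_apply i).comp ((measurable_pi_apply p).comp measurable_fst)

lemma measurable_update_history (k : ℕ) : Measurable (Function.uncurry
    fun (ω : (ℕ → ℕ → X) × (ℕ → ℕ → ℕ)) (az : (ℕ → ℕ) × (ℕ → X)) =>
      (Function.update ω.1 (k + 1) az.2, Function.update ω.2 k az.1)) :=
  ((measurable_update' (a := k + 1)).comp (g := fun q : (ℕ → ℕ → X) × (ℕ → X) => _)
      (f := fun q : ((ℕ → ℕ → X) × (ℕ → ℕ → ℕ)) × ((ℕ → ℕ) × (ℕ → X)) => (q.1.1, q.2.2))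
      (by fun_prop)).prodMk
    ((measurable_update' (a := k)).comp (g := fun q : (ℕ → ℕ → ℕ) × (ℕ → ℕ) => _)
      (f := fun q : ((ℕ → ℕ → X) × (ℕ → ℕ → ℕ)) × ((ℕ → ℕ) × (ℕ → X)) => (q.1.2, q.2.1))
      (by fun_prop))

lemma measurable_update_history_right (k : ℕ) (ω : (ℕ → ℕ → X) × (ℕ → ℕ → ℕ)) :
    Measurable fun az : (ℕ → ℕ) × (ℕ → X) =>
      (Function.update ω.1 (k + 1) az.2, Function.update ω.2 k az.1) :=
  (measurable_update_history k).comp measurable_prodMk_left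

variable [Nonempty X] {M : ℕ → Kernel X X} {G : ℕ → X → ℝ} {Np : ℕ → ℕ}

lemma pfStep_eq (p : ℕ) (z : ℕ → X) : pfStep M G Np p z =
    (Measure.pi fun _ : Fin (Np (p + 1)) => offspringLaw (M (p + 1)) (G p) (Np p) z).map fun f =>
      (padF fun i => (f i).1, padF fun i => (f i).2) := rfl

lemma measurable_initial_history (m : ℕ) : Measurable fun f : Fin m → X =>
    ((fun p => if p = 0 then padF f else fun _ => Classical.arbitrary X, fun _ _ => 0) :
      (ℕ → ℕ → X) × (ℕ → ℕ → ℕ)) := by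
  refine Measurable.prodMk (measurable_pi_lambda _ fun p => ?_) measurable_const
  split_ifs
  · exact measurable_padF
  · exact measurable_const

variable {M0 : Measure X} [IsProbabilityMeasure M0]

lemma integral_pairMean_pfLaw_zero (hN : 0 < Np 0) {F : X × X → ℝ} (hF : BddMeas F) :
    ∫ ω, pairMean (Np 0) F (ω.1 0) ∂(pfLaw M0 M G Np 0)
      = (Np 0 : ℝ)⁻¹ * ∫ y, F (y, y) ∂M0 + (1 - (Np 0 : ℝ)⁻¹) * ∫ q, F q ∂(M0.prod M0) := by
  have hB : BddMeas fun ω : (ℕ → ℕ → X) × (ℕ → ℕ → ℕ) => pairMean (Np 0) F (ω.1 0) :=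
    (bddMeas_pairMean hF).comp ((measurable_pi_apply 0).comp measurable_fst)
  rw [pfLaw, integral_map (measurable_initial_history _).aemeasurable
    hB.measurable.aestronglyMeasurable]
  simp only [if_true, pairMean_padF]
  exact integral_pi_sum_sum M0 hF hN

variable [∀ p, IsMarkovKernel (M p)]

lemma measurable_padF_pair (m : ℕ) : Measurable fun f : Fin m → ℕ × X =>
    ((padF fun i => (f i).1 : ℕ → ℕ), (padF fun i => (f i).2 : ℕ → X)) :=
  (measurable_padF.comp (by fun_prop)).prodMk (measurable_padF.comp (by fun_prop))

lemma isProbabilityMeasure_pfStep {p : ℕ} (hpos : ∀ x, 0 < G p x) (hN : 0 < Np p) (z : ℕ → X) :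
    IsProbabilityMeasure (pfStep M G Np p z) := by
  have := isProbabilityMeasure_offspringLaw (K := M (p + 1)) hpos hN z
  rw [pfStep_eq]
  exact Measure.isProbabilityMeasure_map (measurable_padF_pair _).aemeasurable

lemma measurable_pfStep {p : ℕ} (hG : Measurable (G p)) (hpos : ∀ x, 0 < G p x)
    (hN : 0 < Np p) : Measurable (pfStep M G Np p) := by
  have h := measurable_measure_pi (ι := Fin (Np (p + 1))) (measurable_offspringLaw
    (K := M (p + 1)) (m := Np p) hG) (isProbabilityMeasure_offspringLaw hpos hN)
  exact (Measure.measurable_map _ (measurable_padF_pair _)).comp h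

/-- The transition law of the whole particle history. -/
def pfKer (M : ℕ → Kernel X X) (G : ℕ → X → ℝ) (Np : ℕ → ℕ) (k : ℕ)
    (ω : (ℕ → ℕ → X) × (ℕ → ℕ → ℕ)) : Measure ((ℕ → ℕ → X) × (ℕ → ℕ → ℕ)) :=
  (pfStep M G Np k (ω.1 k)).map fun az =>
    (Function.update ω.1 (k + 1) az.2, Function.update ω.2 k az.1)

lemma measurable_pfKer {k : ℕ} (hG : Measurable (G k)) (hpos : ∀ x, 0 < G k x)
    (hN : 0 < Np k) : Measurable (pfKer M G Np k) :=
  measurable_measure_map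
    ((measurable_pfStep hG hpos hN).comp ((measurable_pi_apply k).comp measurable_fst))
    (fun _ => isProbabilityMeasure_pfStep hpos hN _) (measurable_update_history k)

lemma isProbabilityMeasure_pfKer {k : ℕ} (hpos : ∀ x, 0 < G k x) (hN : 0 < Np k)
    (ω : (ℕ → ℕ → X) × (ℕ → ℕ → ℕ)) : IsProbabilityMeasure (pfKer M G Np k ω) := by
  have := isProbabilityMeasure_pfStep (M := M) hpos hN (ω.1 k)
  exact Measure.isProbabilityMeasure_map (measurable_update_history_right k ω).aemeasurable

lemma isProbabilityMeasure_pfLaw (k : ℕ) (hG : ∀ p < k, Measurable (G p))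
    (hpos : ∀ p < k, ∀ x, 0 < G p x) (hN : ∀ p < k, 0 < Np p) :
    IsProbabilityMeasure (pfLaw M0 M G Np k) := by
  induction k with
  | zero => exact Measure.isProbabilityMeasure_map (measurable_initial_history _).aemeasurable
  | succ k ih =>
    have := ih (fun p hp => hG p (by omega)) (fun p hp => hpos p (by omega))
      (fun p hp => hN p (by omega))
    exact isProbabilityMeasure_bind (m := pfLaw M0 M G Np k) (f := pfKer M G Np k)
      (measurable_pfKer (hG k (by omega)) (hpos k (by omega)) (hN k (by omega))).aemeasurable
      (ae_of_all _ (isProbabilityMeasure_pfKer (hpos k (by omega)) (hN k (by omega))))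

lemma integral_pairMean_pfStep {k : ℕ} (hpos : ∀ x, 0 < G k x) (hN : 0 < Np k)
    (hN' : 0 < Np (k + 1)) {F : X × X → ℝ} (hF : BddMeas F) (z : ℕ → X) :
    ((Np k : ℝ)⁻¹ * ∑ i ∈ Finset.range (Np k), G k (z i)) ^ 2 *
      ∫ az, pairMean (Np (k + 1)) F az.2 ∂(pfStep M G Np k z)
      = pairMean (Np k) (pairStep (M (k + 1)) (G k) (Np (k + 1) : ℝ)⁻¹ F) z := by
  have := isProbabilityMeasure_offspringLaw (K := M (k + 1)) hpos hN z
  rw [pfStep_eq, integral_map (measurable_padF_pair _).aemeasurable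
    ((bddMeas_pairMean hF).comp measurable_snd).measurable.aestronglyMeasurable]
  simp only [pairMean_padF]
  have h := integral_pi_sum_sum (offspringLaw (M (k + 1)) (G k) (Np k) z)
    (F := fun q => F (q.1.2, q.2.2)) (hF.comp (by fun_prop)) hN'
  rw [h]
  exact mean_sq_mul_integral_offspring hpos hN _ hF z

lemma integral_pairMean_pfLaw_succ (k : ℕ) (hG : ∀ p ≤ k, BddMeas (G p))
    (hpos : ∀ p ≤ k, ∀ x, 0 < G p x) (hN : ∀ p ≤ k + 1, 0 < Np p) {F : X × X → ℝ}
    (hF : BddMeas F) :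
    ∫ ω, (∏ p ∈ Finset.range (k + 1), etaN Np p (G p) ω) ^ 2 *
        pairMean (Np (k + 1)) F (ω.1 (k + 1)) ∂(pfLaw M0 M G Np (k + 1))
      = ∫ ω, (∏ p ∈ Finset.range k, etaN Np p (G p) ω) ^ 2 *
        pairMean (Np k) (pairStep (M (k + 1)) (G k) (Np (k + 1) : ℝ)⁻¹ F) (ω.1 k)
          ∂(pfLaw M0 M G Np k) := by
  have := isProbabilityMeasure_pfLaw (M0 := M0) (M := M) (Np := Np) k
    (fun p hp => (hG p hp.le).measurable) (fun p hp => hpos p hp.le) fun p hp => hN p (by omega)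
  have hprod : BddMeas fun ω : (ℕ → ℕ → X) × (ℕ → ℕ → ℕ) =>
      ∏ p ∈ Finset.range (k + 1), etaN Np p (G p) ω :=
    .prod _ fun p hp => bddMeas_etaN Np p (hG p (by simpa [Nat.lt_succ_iff] using hp))
  have hint : BddMeas fun ω : (ℕ → ℕ → X) × (ℕ → ℕ → ℕ) =>
      (∏ p ∈ Finset.range (k + 1), etaN Np p (G p) ω) ^ 2 *
        pairMean (Np (k + 1)) F (ω.1 (k + 1)) := by
    simp_rw [pow_two]
    exact (hprod.mul hprod).mul
      ((bddMeas_pairMean hF).comp ((measurable_pi_apply (k + 1)).comp measurable_fst))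
  change ∫ ω, _ ∂((pfLaw M0 M G Np k).bind (pfKer M G Np k)) = _
  rw [hint.integral_bind _ (measurable_pfKer (hG k le_rfl).measurable (hpos k le_rfl)
    (hN k (by omega))) (isProbabilityMeasure_pfKer (hpos k le_rfl) (hN k (by omega)))]
  refine integral_congr_ae (ae_of_all _ fun ω => ?_)
  simp only
  rw [pfKer, integral_map (measurable_update_history_right k ω).aemeasurable
    hint.measurable.aestronglyMeasurable]
  have heta : ∀ az : (ℕ → ℕ) × (ℕ → X), ∏ p ∈ Finset.range (k + 1), etaN Np p (G p)
      (Function.update ω.1 (k + 1) az.2, Function.update ω.2 k az.1)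
      = ∏ p ∈ Finset.range (k + 1), etaN Np p (G p) ω := fun az => by
    refine Finset.prod_congr rfl fun p hp => ?_
    have hne : p ≠ k + 1 := by have := Finset.mem_range.1 hp; omega
    simp [etaN, Function.update_of_ne hne]
  simp only [heta, Function.update_self]
  rw [integral_const_mul, ← integral_pairMean_pfStep (hpos k le_rfl) (hN k (by omega))
    (hN (k + 1) le_rfl) hF, Finset.prod_range_succ, mul_pow, mul_assoc]
  rfl

end ParticleFilter

section MarkovPath

variable {Y : Type*} [MeasurableSpace Y] {κ : ℕ → Y → Measure Y}

lemma measurable_markovPath_step (hκ : ∀ p, Measurable (κ p))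
    (hp : ∀ p y, IsProbabilityMeasure (κ p y)) (k : ℕ) :
    Measurable fun ω : ℕ → Y => (κ (k + 1) (ω k)).map fun y => Function.update ω (k + 1) y :=
  measurable_measure_map ((hκ (k + 1)).comp (measurable_pi_apply k)) (fun _ => hp _ _)
    (measurable_update' (a := k + 1))

lemma isProbabilityMeasure_markovPath_step (hp : ∀ p y, IsProbabilityMeasure (κ p y)) (k : ℕ)
    (ω : ℕ → Y) :
    IsProbabilityMeasure ((κ (k + 1) (ω k)).map fun y => Function.update ω (k + 1) y) := by
  have := hp (k + 1) (ω k)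
  exact Measure.isProbabilityMeasure_map (measurable_update ω).aemeasurable

lemma isProbabilityMeasure_markovPath {μ0 : Measure Y} [IsProbabilityMeasure μ0]
    (hκ : ∀ p, Measurable (κ p)) (hp : ∀ p y, IsProbabilityMeasure (κ p y)) (k : ℕ) :
    IsProbabilityMeasure (markovPath μ0 κ k) := by
  induction k with
  | zero =>
    exact Measure.isProbabilityMeasure_map
      (measurable_pi_lambda _ fun _ => measurable_id).aemeasurable
  | succ k ih =>
    exact isProbabilityMeasure_bind (measurable_markovPath_step hκ hp k).aemeasurable
      (ae_of_all _ (isProbabilityMeasure_markovPath_step hp k))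

lemma markovPath_congr {μ0 μ1 : Measure Y} {κ' : ℕ → Y → Measure Y} (k : ℕ) (h0 : μ0 = μ1)
    (h : ∀ p ≤ k, κ p = κ' p) : markovPath μ0 κ k = markovPath μ1 κ' k := by
  induction k with
  | zero => rw [markovPath, markovPath, h0]
  | succ k ih =>
    rw [markovPath, markovPath, ih fun p hp => h p (by omega), h (k + 1) le_rfl]

end MarkovPath

section DoubledChain

variable {X : Type*} [MeasurableSpace X] {M : ℕ → Kernel X X} {G : ℕ → X → ℝ}

lemma integral_pairInit {M0 : Measure X} {F : X × X → ℝ} (hF : BddMeas F) (b : ℕ → Bool) :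
    ∫ q, F q ∂(pairInit M0 b)
      = if b 0 then ∫ y, F (y, y) ∂M0 else ∫ q, F q ∂(M0.prod M0) := by
  unfold pairInit
  split_ifs
  · exact integral_map (measurable_id.prodMk measurable_id).aemeasurable
      hF.measurable.aestronglyMeasurable
  · rfl

lemma integral_pairKer {F : X × X → ℝ} (hF : BddMeas F) (b : ℕ → Bool) (p : ℕ) (q : X × X) :
    ∫ y, F y ∂(pairKer M b p q)
      = if b p then ∫ y, F (y, y) ∂(M p q.1) else ∫ y, F y ∂((M p q.1).prod (M p q.2)) := by
  unfold pairKer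
  split_ifs
  · exact integral_map (measurable_id.prodMk measurable_id).aemeasurable
      hF.measurable.aestronglyMeasurable
  · rfl

lemma isProbabilityMeasure_pairInit {M0 : Measure X} [IsProbabilityMeasure M0] (b : ℕ → Bool) :
    IsProbabilityMeasure (pairInit M0 b) := by
  unfold pairInit
  split_ifs
  · exact Measure.isProbabilityMeasure_map (measurable_id.prodMk measurable_id).aemeasurable
  · infer_instance

lemma muB_congr {M0 : Measure X} {k : ℕ} {b b' : ℕ → Bool} (h : ∀ p ≤ k, b p = b' p) (F : X × X → ℝ) :
    muB M0 M G k b F = muB M0 M G k b' F := by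
  unfold muB
  rw [markovPath_congr (κ' := pairKer M b') (μ1 := pairInit M0 b') k]
  · simp only [pairInit, h 0 (Nat.zero_le _)]
  · intro p hp
    funext q
    simp only [pairKer, h p hp]

lemma pairStep_eq (k p : ℕ) (t : ℝ) {F : X × X → ℝ} (hF : BddMeas F) :
    pairStep (M p) (G k) t F = fun q =>
      t * (G k q.1 * G k q.2 * ∫ y, F y ∂(pairKer M (fun _ => true) p q)) +
      (1 - t) * (G k q.1 * G k q.2 * ∫ y, F y ∂(pairKer M (fun _ => false) p q)) := by
  funext q
  simp only [pairStep, integral_pairKer hF, if_true, Bool.false_eq_true, if_false]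
  ring

lemma muB_zero {M0 : Measure X} (b : ℕ → Bool) {F : X × X → ℝ} (hF : BddMeas F) :
    muB M0 M G 0 b F = if b 0 then ∫ y, F (y, y) ∂M0 else ∫ q, F q ∂(M0.prod M0) := by
  have hm : Measurable fun (y : X × X) (_ : ℕ) => y := measurable_pi_lambda _ fun _ => measurable_id
  rw [← integral_pairInit hF, muB, markovPath, integral_map hm.aemeasurable]
  · simp
  · simpa using (hF.comp (measurable_pi_apply 0)).measurable.aestronglyMeasurable

variable [∀ p, IsMarkovKernel (M p)]

lemma isProbabilityMeasure_pairKer (b : ℕ → Bool) (p : ℕ) (q : X × X) :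
    IsProbabilityMeasure (pairKer M b p q) := by
  unfold pairKer
  split_ifs
  · exact Measure.isProbabilityMeasure_map (measurable_id.prodMk measurable_id).aemeasurable
  · infer_instance

lemma measurable_pairKer (b : ℕ → Bool) (p : ℕ) : Measurable (pairKer M b p) := by
  unfold pairKer
  by_cases h : b p
  · simp only [h, if_true]
    exact (Measure.measurable_map _ (measurable_id.prodMk measurable_id)).comp
      ((M p).measurable.comp measurable_fst)
  · simp only [h]
    have hk := (((M p).comap _ (measurable_fst (α := X) (β := X))) ×ₖ
      ((M p).comap _ (measurable_snd (α := X) (β := X)))).measurable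
    convert hk using 2 with q
    simp [Kernel.prod_apply]

variable {M0 : Measure X} [IsProbabilityMeasure M0]

lemma bddMeas_chain_weight {k : ℕ} (hG : ∀ p < k, BddMeas (G p)) {F : X × X → ℝ}
    (hF : BddMeas F) : BddMeas fun ω : ℕ → X × X =>
      F (ω k) * ∏ p ∈ Finset.range k, G p (ω p).1 * G p (ω p).2 :=
  (hF.comp (measurable_pi_apply k)).mul <| .prod _ fun p hp =>
    ((hG p (Finset.mem_range.1 hp)).comp (measurable_fst.comp (measurable_pi_apply p))).mul
      ((hG p (Finset.mem_range.1 hp)).comp (measurable_snd.comp (measurable_pi_apply p)))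

lemma muB_succ (k : ℕ) (b : ℕ → Bool) (hG : ∀ p ≤ k, BddMeas (G p)) {F : X × X → ℝ}
    (hF : BddMeas F) : muB M0 M G (k + 1) b F
      = muB M0 M G k b fun q => G k q.1 * G k q.2 * ∫ y, F y ∂(pairKer M b (k + 1) q) := by
  have := isProbabilityMeasure_pairInit (M0 := M0) b
  have := isProbabilityMeasure_markovPath (μ0 := pairInit M0 b) (measurable_pairKer (M := M) b)
    (isProbabilityMeasure_pairKer b) k
  have hB := bddMeas_chain_weight (fun p (hp : p < k + 1) => hG p (by omega)) hF
  rw [muB, markovPath, hB.integral_bind _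
    (measurable_markovPath_step (measurable_pairKer b) (isProbabilityMeasure_pairKer b) k)
    (isProbabilityMeasure_markovPath_step (isProbabilityMeasure_pairKer b) k), muB]
  refine integral_congr_ae (ae_of_all _ fun ω => ?_)
  simp only
  rw [integral_map (measurable_update ω).aemeasurable hB.measurable.aestronglyMeasurable]
  have hw : ∀ y : X × X, ∏ p ∈ Finset.range (k + 1),
      G p (Function.update ω (k + 1) y p).1 * G p (Function.update ω (k + 1) y p).2
      = ∏ p ∈ Finset.range (k + 1), G p (ω p).1 * G p (ω p).2 := fun y => by
    refine Finset.prod_congr rfl fun p hp => ?_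
    have hne : p ≠ k + 1 := by have := Finset.mem_range.1 hp; omega
    rw [Function.update_of_ne hne]
  simp only [hw, Function.update_self]
  rw [integral_mul_const, Finset.prod_range_succ]
  ring

lemma muB_linear {k : ℕ} (b : ℕ → Bool) (hG : ∀ p < k, BddMeas (G p)) {F F' : X × X → ℝ}
    (hF : BddMeas F) (hF' : BddMeas F') (s t : ℝ) :
    muB M0 M G k b (fun q => s * F q + t * F' q)
      = s * muB M0 M G k b F + t * muB M0 M G k b F' := by
  have := isProbabilityMeasure_pairInit (M0 := M0) b
  have := isProbabilityMeasure_markovPath (μ0 := pairInit M0 b) (measurable_pairKer (M := M) b)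
    (isProbabilityMeasure_pairKer b) k
  unfold muB
  rw [← integral_const_mul, ← integral_const_mul, ← integral_add]
  · congr 1
    funext ω
    ring
  · exact ((bddMeas_chain_weight hG hF).integrable _).const_mul _
  · exact ((bddMeas_chain_weight hG hF').integrable _).const_mul _

lemma bddMeas_weighted_pairKer {k : ℕ} (hG : BddMeas (G k)) (b : ℕ → Bool) (p : ℕ)
    {F : X × X → ℝ} (hF : BddMeas F) :
    BddMeas fun q : X × X => G k q.1 * G k q.2 * ∫ y, F y ∂(pairKer M b p q) :=
  ((hG.comp measurable_fst).mul (hG.comp measurable_snd)).mul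
    (hF.integral (measurable_pairKer b p) (isProbabilityMeasure_pairKer b p))

lemma bddMeas_pairStep {k : ℕ} (hG : BddMeas (G k)) (p : ℕ) (t : ℝ)
    {F : X × X → ℝ} (hF : BddMeas F) : BddMeas (pairStep (M p) (G k) t F) := by
  rw [pairStep_eq k p t hF]
  exact ((BddMeas.const _).mul (bddMeas_weighted_pairKer hG _ _ hF)).add
    ((BddMeas.const _).mul (bddMeas_weighted_pairKer hG _ _ hF))

lemma muB_pairStep (k : ℕ) (b : ℕ → Bool) (hG : ∀ p ≤ k, BddMeas (G p)) {F : X × X → ℝ}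
    (hF : BddMeas F) (t : ℝ) :
    muB M0 M G k b (pairStep (M (k + 1)) (G k) t F)
      = t * muB M0 M G (k + 1) (Function.update b (k + 1) true) F
        + (1 - t) * muB M0 M G (k + 1) (Function.update b (k + 1) false) F := by
  have hs : ∀ c : Bool, muB M0 M G (k + 1) (Function.update b (k + 1) c) F
      = muB M0 M G k b
        fun q => G k q.1 * G k q.2 * ∫ y, F y ∂(pairKer M (fun _ => c) (k + 1) q) := fun c => by
    rw [muB_succ k _ hG hF, muB_congr (b' := b)]
    · simp only [integral_pairKer hF, Function.update_self]
    · intro p hp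
      rw [Function.update_of_ne (by omega)]
  rw [hs, hs, pairStep_eq k (k + 1) t hF, muB_linear b (fun p hp => hG p hp.le)
    (bddMeas_weighted_pairKer (hG k le_rfl) _ _ hF)
    (bddMeas_weighted_pairKer (hG k le_rfl) _ _ hF)]

end DoubledChain

lemma extB_snoc (n : ℕ) (b : Fin (n + 1) → Bool) (c : Bool) :
    extB (n + 1) (Fin.snoc b c) = Function.update (extB n b) (n + 1) c := by
  funext p
  rcases lt_trichotomy p (n + 1) with h | rfl | h
  · have h' : p < n + 1 + 1 := by omega
    rw [Function.update_of_ne h.ne]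
    simp [extB, h, h', Fin.snoc]
  · simp [extB, Fin.snoc]
  · rw [Function.update_of_ne h.ne']
    have h1 : ¬ p < n + 1 + 1 := by omega
    have h2 : ¬ p < n + 1 := by omega
    simp [extB, h1, h2]

lemma sum_extB_succ (n : ℕ) (f : (ℕ → Bool) → ℝ) :
    ∑ b : Fin (n + 1 + 1) → Bool, f (extB (n + 1) b)
      = ∑ b : Fin (n + 1) → Bool, (f (Function.update (extB n b) (n + 1) true) +
          f (Function.update (extB n b) (n + 1) false)) := by
  rw [← (Fin.snocEquiv fun _ : Fin (n + 1 + 1) => Bool).sum_comp, Fintype.sum_prod_type_right]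
  refine Finset.sum_congr rfl fun b _ => ?_
  rw [Fintype.sum_bool]
  simp only [← extB_snoc]
  rfl

/-- Expansion of the second-moment functional of the particle approximation over binary strings. -/
lemma integral_pairMean_pfLaw {X : Type*} [MeasurableSpace X] [Nonempty X] {M0 : Measure X}
    [IsProbabilityMeasure M0] {M : ℕ → Kernel X X} [∀ p, IsMarkovKernel (M p)] {G : ℕ → X → ℝ}
    {Np : ℕ → ℕ} (n : ℕ) (hG : ∀ p < n, BddMeas (G p)) (hpos : ∀ p < n, ∀ x, 0 < G p x)
    (hN : ∀ p ≤ n, 0 < Np p) {F : X × X → ℝ} (hF : BddMeas F) :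
    ∫ ω, (∏ p ∈ Finset.range n, etaN Np p (G p) ω) ^ 2 * pairMean (Np n) F (ω.1 n)
        ∂(pfLaw M0 M G Np n)
      = ∑ b : Fin (n + 1) → Bool,
          (∏ p ∈ Finset.range (n + 1),
            if extB n b p then (Np p : ℝ)⁻¹ else 1 - (Np p : ℝ)⁻¹) *
            muB M0 M G n (extB n b) F := by
  induction n generalizing F with
  | zero =>
    have h := integral_pairMean_pfLaw_zero (M0 := M0) (M := M) (G := G) (hN 0 le_rfl) hF
    simp only [Finset.range_zero, Finset.prod_empty, one_pow, one_mul, h, muB_zero _ hF,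
      zero_add, Finset.prod_range_one]
    rw [← (Equiv.funUnique (Fin 1) Bool).symm.sum_comp, Fintype.sum_bool]
    simp [extB]
  | succ n ih =>
    have hG' : ∀ p ≤ n, BddMeas (G p) := fun p hp => hG p (by omega)
    rw [integral_pairMean_pfLaw_succ n hG' (fun p hp => hpos p (by omega)) hN hF,
      ih (fun p hp => hG p (by omega)) (fun p hp => hpos p (by omega))
        (fun p hp => hN p (by omega)) (bddMeas_pairStep (hG' n le_rfl) _ _ hF),
      sum_extB_succ n fun b => (∏ p ∈ Finset.range (n + 1 + 1),
        if b p then (Np p : ℝ)⁻¹ else 1 - (Np p : ℝ)⁻¹) * muB M0 M G (n + 1) b F]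
    refine Finset.sum_congr rfl fun b _ => ?_
    have hw : ∀ c : Bool, (∏ p ∈ Finset.range (n + 1),
        if Function.update (extB n b) (n + 1) c p then (Np p : ℝ)⁻¹ else 1 - (Np p : ℝ)⁻¹)
        = ∏ p ∈ Finset.range (n + 1),
          if extB n b p then (Np p : ℝ)⁻¹ else 1 - (Np p : ℝ)⁻¹ := fun c => by
      refine Finset.prod_congr rfl fun p hp => ?_
      rw [Function.update_of_ne (Finset.mem_range.1 hp).ne]
    rw [muB_pairStep n _ hG' hF, Finset.prod_range_succ _ (n + 1),
      Finset.prod_range_succ _ (n + 1), hw, hw]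
    simp only [Function.update_self, if_true, Bool.false_eq_true, if_false]
    ring

theorem statement7
    {X : Type*} [MeasurableSpace X] [Nonempty X] (hX : ∃ x y : X, x ≠ y) (n : ℕ)
    (M0 : Measure X) [IsProbabilityMeasure M0]
    (M : ℕ → Kernel X X) [∀ p, IsMarkovKernel (M p)]
    (G : ℕ → X → ℝ) (hGm : ∀ p ≤ n, Measurable (G p))
    (hGpos : ∀ p ≤ n, ∀ x, 0 < G p x) (hGbd : ∀ p ≤ n, ∃ C, ∀ x, G p x ≤ C)
    (c : ℕ → ℝ) (hc : ∀ p ≤ n, 0 < c p)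
    (φ : X → ℝ) (hφm : Measurable φ) (hφb : ∃ C, ∀ x, |φ x| ≤ C) :
    ∀ N : ℕ, 1 ≤ N → (∀ p ≤ n, 2 ≤ npart c N p) →
      ∫ ω, gammaN G (npart c N) n φ ω ^ 2 ∂(pfLaw M0 M G (npart c N) n)
        = ∑ b : Fin (n + 1) → Bool,
            (∏ p ∈ Finset.range (n + 1),
                if extB n b p then ((npart c N p : ℝ))⁻¹ else 1 - ((npart c N p : ℝ))⁻¹) *
              muB M0 M G n (extB n b) (tens φ) := by
  intro N _ hN
  obtain ⟨C, hC⟩ := hφb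
  have hF : BddMeas (tens φ) := by
    have h : BddMeas φ := ⟨hφm, C, hC⟩
    exact (h.comp measurable_fst).mul (h.comp measurable_snd)
  rw [← integral_pairMean_pfLaw n (fun p hp => ⟨hGm p hp.le, (hGbd p hp.le).imp fun D hD x => by
    rw [abs_of_pos (hGpos p hp.le x)]; exact hD x⟩) (fun p hp => hGpos p hp.le)
    (fun p hp => zero_lt_two.trans_le (hN p hp)) hF]
  congr 1
  funext ω
  simp only [gammaN, etaN, pairMean, tens]
  rw [← Finset.sum_mul_sum]
  ring
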